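/- The free group of rank 2 is a limit of 2-markings of Thompson's group F: there is a sequence of generating pairs (X_0^{(n)}, X_1^{(n)}) of F such that for every n, no nonempty reduced word of length at most n in X_0^{(n)}, X_1^{(n)} and their inverses represents the identity in F. -/

import Mathlib

/-- The defining relators of Thompson's group `F`:
`x_j x_i x_{j+1}⁻¹ x_i⁻¹` for `i < j`, encoding `x_j x_i = x_i x_{j+1}`. -/
def thompsonRels : Set (FreeGroup ℕ) :=
  {r | ∃ i j : ℕ, i < j ∧
    r = FreeGroup.of j * FreeGroup.of i * (FreeGroup.of (j + 1))⁻¹ * (FreeGroup.of i)⁻¹}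

/-- Thompson's group `F`, via its infinite presentation
`⟨x_0, x_1, … | x_j x_i = x_i x_{j+1} for i < j⟩`. -/
abbrev ThompsonF : Type := PresentedGroup thompsonRels

/-- The generator `x_n` of Thompson's group `F`. -/
def x (n : ℕ) : ThompsonF := PresentedGroup.of n

open Subgroup

lemma x_mul_x {i j : ℕ} (h : i < j) : x j * x i = x i * x (j + 1) := by
  have h1 : (PresentedGroup.mk thompsonRels) (FreeGroup.of j * FreeGroup.of i *
      (FreeGroup.of (j + 1))⁻¹ * (FreeGroup.of i)⁻¹) = 1 :=
    PresentedGroup.one_of_mem ⟨i, j, h, rfl⟩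
  simp only [map_mul, map_inv] at h1
  have h2 : x j * x i * (x (j + 1))⁻¹ * (x i)⁻¹ = 1 := h1
  rw [mul_inv_eq_one, mul_inv_eq_iff_eq_mul] at h2
  exact h2

lemma x_conj {i j : ℕ} (h : i < j) : (x i)⁻¹ * x j * x i = x (j + 1) := by
  rw [mul_assoc, x_mul_x h, inv_mul_cancel_left]

lemma x_conj_mul_inv {i j : ℕ} (h : i < j) :
    (x i)⁻¹ * (x j * (x (j + 1))⁻¹) * x i = x (j + 1) * (x (j + 2))⁻¹ := by
  rw [← x_conj h, ← x_conj (show i < j + 1 by omega), ← x_conj h]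
  simp [mul_assoc]

/-- The subgroup generated by the `x i` with `c ≤ i`. -/
def tail (c : ℕ) : Subgroup ThompsonF := Subgroup.closure (x '' Set.Ici c)

/-- The centralizer of the `x i` with `c ≤ i`. -/
def tailCentralizer (c : ℕ) : Subgroup ThompsonF := centralizer (x '' Set.Ici c)

lemma x_mem_tail {c i : ℕ} (h : c ≤ i) : x i ∈ tail c := subset_closure ⟨i, h, rfl⟩

lemma tail_anti {c d : ℕ} (h : c ≤ d) : tail d ≤ tail c :=
  closure_mono (Set.image_mono (Set.Ici_subset_Ici.2 h))

lemma tailCentralizer_mono {c d : ℕ} (h : c ≤ d) : tailCentralizer c ≤ tailCentralizer d :=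
  centralizer_le (Set.image_mono (Set.Ici_subset_Ici.2 h))

lemma mem_tailCentralizer {c : ℕ} {g : ThompsonF} :
    g ∈ tailCentralizer c ↔ ∀ j, c ≤ j → Commute (x j) g := by
  simp [tailCentralizer, mem_centralizer_iff, Commute, SemiconjBy]

lemma commute_of_mem_tail {c : ℕ} {g h : ThompsonF} (hg : g ∈ tail c)
    (hh : h ∈ tailCentralizer c) : Commute g h := by
  have h1 : tail c ≤ centralizer {h} := by
    refine (closure_le _).2 ?_
    rintro _ ⟨j, hj, rfl⟩
    simpa [mem_centralizer_iff] using (mem_tailCentralizer.1 hh j hj).eq.symm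
  exact ((mem_centralizer_iff.1 (h1 hg)) h rfl).symm

lemma x_mul_inv_mem_tailCentralizer {i k : ℕ} (h : i ≤ k) :
    x i * (x k)⁻¹ ∈ tailCentralizer (k + 1) := by
  refine mem_tailCentralizer.2 fun j hj => ?_
  have h1 := x_mul_x (show i < j by omega)
  have h2 := x_mul_x (show k < j by omega)
  have h3 : x (j + 1) * (x k)⁻¹ = (x k)⁻¹ * x j := by
    rw [mul_inv_eq_iff_eq_mul, mul_assoc, h2, inv_mul_cancel_left]
  change x j * (x i * (x k)⁻¹) = x i * (x k)⁻¹ * x j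
  rw [← mul_assoc, h1, mul_assoc, h3, mul_assoc]

/-- The `k`-fold shift of an element, i.e. its conjugate by the `k`-th power of `x 0`. -/
def shift (k : ℕ) : ThompsonF →* ThompsonF := (MulAut.conj ((x 0)⁻¹ ^ k)).toMonoidHom

lemma shift_apply (k : ℕ) (g : ThompsonF) : shift k g = (x 0)⁻¹ ^ k * g * x 0 ^ k := by
  change (x 0)⁻¹ ^ k * g * ((x 0)⁻¹ ^ k)⁻¹ = _
  rw [inv_pow, inv_inv]

lemma shift_succ (k : ℕ) (g : ThompsonF) : shift (k + 1) g = shift k (shift 1 g) := by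
  simp only [shift_apply, pow_succ (x 0)⁻¹, pow_succ' (x 0), pow_zero]
  group

lemma shift_zero (g : ThompsonF) : shift 0 g = g := by simp [shift_apply]

lemma shift_x (k : ℕ) {j : ℕ} (h : 1 ≤ j) : shift k (x j) = x (j + k) := by
  induction k generalizing j with
  | zero => exact shift_zero _
  | succ k ih =>
    rw [shift_succ, shift_apply 1, pow_one, pow_one, x_conj h, ih (by omega)]
    congr 1
    omega

lemma shift_mem_tail (k : ℕ) {c : ℕ} (hc : 1 ≤ c) {g : ThompsonF} (hg : g ∈ tail c) :
    shift k g ∈ tail (c + k) := by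
  have h1 : tail c ≤ (tail (c + k)).comap (shift k) := by
    refine (closure_le _).2 ?_
    rintro _ ⟨j, hj, rfl⟩
    have hj' : c ≤ j := hj
    rw [SetLike.mem_coe, mem_comap, shift_x k (hc.trans hj')]
    exact x_mem_tail (by omega)
  exact h1 hg

lemma shift_mem_tailCentralizer (k : ℕ) {c : ℕ} (hc : 1 ≤ c) {g : ThompsonF}
    (hg : g ∈ tailCentralizer c) : shift k g ∈ tailCentralizer (c + k) := by
  refine mem_tailCentralizer.2 fun j hj => ?_
  obtain ⟨i, rfl⟩ := Nat.exists_eq_add_of_le' (show k ≤ j by omega)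
  rw [← shift_x k (show 1 ≤ i by omega)]
  exact (mem_tailCentralizer.1 hg i (by omega)).map (shift k)

lemma shift_mem_iff {H : Subgroup ThompsonF} (h0 : x 0 ∈ H) (k : ℕ) (g : ThompsonF) :
    shift k g ∈ H ↔ g ∈ H := by
  rw [shift_apply, H.mul_mem_cancel_right (pow_mem h0 k),
    H.mul_mem_cancel_left (pow_mem (inv_mem h0) k)]

lemma eq_top_of_x_mem {H : Subgroup ThompsonF} (h0 : x 0 ∈ H) {k : ℕ} (hk : 1 ≤ k)
    (h : x k ∈ H) : H = ⊤ := by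
  have h1 : x 1 ∈ H := by
    rw [← shift_mem_iff h0 (k - 1), shift_x _ le_rfl, show 1 + (k - 1) = k by omega]
    exact h
  rw [eq_top_iff, ← PresentedGroup.closure_range_of thompsonRels, closure_le]
  rintro _ ⟨j, rfl⟩
  change x j ∈ H
  rcases Nat.eq_zero_or_pos j with rfl | hj
  · exact h0
  · have h2 := (shift_mem_iff h0 (j - 1) _).2 h1
    rwa [shift_x _ le_rfl, show 1 + (j - 1) = j by omega] at h2

/-- The elements commuting with all but finitely many of the `x i`. -/
def eventualCentralizer : Subgroup ThompsonF where
  carrier := {g | ∃ c, g ∈ tailCentralizer c}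
  one_mem' := ⟨0, one_mem _⟩
  mul_mem' := by
    rintro g h ⟨c, hc⟩ ⟨d, hd⟩
    exact ⟨max c d, mul_mem (tailCentralizer_mono (le_max_left _ _) hc)
      (tailCentralizer_mono (le_max_right _ _) hd)⟩
  inv_mem' := by
    rintro g ⟨c, hc⟩
    exact ⟨c, inv_mem hc⟩

lemma mem_normalizer_eventualCentralizer (i : ℕ) :
    x i ∈ normalizer (eventualCentralizer : Set ThompsonF) := by
  refine mem_normalizer_iff.2 fun h => ⟨?_, ?_⟩
  · rintro ⟨c, hc⟩
    refine ⟨c + i + 1, mem_tailCentralizer.2 fun j hj => ?_⟩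
    have h1 := mem_tailCentralizer.1 hc (j + 1) (by omega)
    have h2 : x j = x i * x (j + 1) * (x i)⁻¹ := by
      rw [← x_mul_x (show i < j by omega), mul_inv_cancel_right]
    rw [h2]
    exact h1.map (MulAut.conj (x i)).toMonoidHom
  · rintro ⟨c, hc⟩
    refine ⟨c + i + 2, mem_tailCentralizer.2 fun j hj => ?_⟩
    obtain ⟨j, rfl⟩ := Nat.exists_eq_add_of_le' (show 1 ≤ j by omega)
    have h1 := mem_tailCentralizer.1 hc j (by omega)
    have h2 := h1.map (MulAut.conj (x i)⁻¹).toMonoidHom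
    simpa [mul_assoc, x_mul_x (show i < j by omega)] using h2

instance : eventualCentralizer.Normal :=
  normalizer_eq_top_iff.1
    (eq_top_of_x_mem (mem_normalizer_eventualCentralizer 0) le_rfl
      (mem_normalizer_eventualCentralizer 1))

section Generation

variable {H : Subgroup ThompsonF} {m : ThompsonF} {l : ℕ}

lemma mul_shift_inv_mem (h0 : x 0 ∈ H) (hl : 1 ≤ l) (hm : m ∈ tail 1)
    (hm' : m ∈ tailCentralizer l) (hb : m * x (2 * l) ∈ H) (k : ℕ) :
    m * (shift k m)⁻¹ ∈ H := by
  have hstep : m * (shift 1 m)⁻¹ ∈ H := by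
    have h1 : (m * x (2 * l))⁻¹ * shift l (m * x (2 * l)) * (m * x (2 * l)) *
        (shift (l + 1) (m * x (2 * l)))⁻¹ ∈ H :=
      mul_mem (mul_mem (mul_mem (inv_mem hb) ((shift_mem_iff h0 _ _).2 hb)) hb)
        (inv_mem ((shift_mem_iff h0 _ _).2 hb))
    rw [← shift_mem_iff h0 l]
    convert h1 using 1
    have e1 : shift l (shift 1 m) = shift (l + 1) m := (shift_succ _ _).symm
    have c1 : Commute (shift l m) m :=
      commute_of_mem_tail (tail_anti (by omega) (shift_mem_tail l le_rfl hm)) hm'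
    have c2 : Commute (x (2 * l)) (shift l m) :=
      mem_tailCentralizer.1 (shift_mem_tailCentralizer l hl hm') _ (by omega)
    have c3 : Commute (x (2 * l + l)) m := mem_tailCentralizer.1 hm' _ (by omega)
    have e2 := x_conj (show 2 * l < 2 * l + l by omega)
    simp only [map_mul, map_inv, e1, shift_x _ (show 1 ≤ 2 * l by omega), mul_inv_rev]
    rw [← add_assoc, ← e2]
    have e3 : (x (2 * l))⁻¹ * m⁻¹ * (shift l m * x (2 * l + l)) * (m * x (2 * l)) =
        shift l m * ((x (2 * l))⁻¹ * x (2 * l + l) * x (2 * l)) := by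
      calc _ = (x (2 * l))⁻¹ * m⁻¹ * shift l m * (x (2 * l + l) * m) * x (2 * l) := by group
        _ = (x (2 * l))⁻¹ * m⁻¹ * (shift l m * m) * x (2 * l + l) * x (2 * l) := by
          rw [c3.eq]; group
        _ = (x (2 * l))⁻¹ * shift l m * x (2 * l + l) * x (2 * l) := by rw [c1.eq]; group
        _ = _ := by rw [c2.inv_left.eq]; group
    rw [e3]
    group
  induction k with
  | zero => simp [shift_zero]
  | succ k ih =>
    have h1 := mul_mem ih ((shift_mem_iff h0 k _).2 hstep)
    rw [map_mul, map_inv, ← shift_succ] at h1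
    simpa [mul_assoc] using h1

lemma normal_inf_eventualCentralizer (h0 : x 0 ∈ H) (hl : 1 ≤ l) (hm : m ∈ tail 1)
    (hm' : m ∈ tailCentralizer l) (hb : m * x (2 * l) ∈ H) :
    (H ⊓ eventualCentralizer).Normal := by
  have hH : ∀ g ∈ H, g ∈ normalizer ((H ⊓ eventualCentralizer : Subgroup _) : Set ThompsonF) := by
    intro g hg
    refine mem_normalizer_iff.2 fun h => ?_
    simp only [mem_inf]
    rw [H.mul_mem_cancel_right (inv_mem hg), H.mul_mem_cancel_left hg,
      Normal.mem_comm_iff inferInstance, inv_mul_cancel_left]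
  have key : ∀ h, ∀ c, h ∈ tailCentralizer c → (m * h * m⁻¹ ∈ H ↔ h ∈ H) := by
    intro h c hc
    have c1 : Commute (shift (max c l) m) h :=
      commute_of_mem_tail (tail_anti (by omega) (shift_mem_tail _ le_rfl hm)) hc
    have h1 := mul_shift_inv_mem h0 hl hm hm' hb (max c l)
    have e1 : m * h * m⁻¹ = (m * (shift (max c l) m)⁻¹) * h * (m * (shift (max c l) m)⁻¹)⁻¹ := by
      calc m * h * m⁻¹ = m * (h * (shift (max c l) m)⁻¹) * shift (max c l) m * m⁻¹ := by group
        _ = _ := by rw [← c1.inv_left.eq]; group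
    rw [e1, H.mul_mem_cancel_right (inv_mem h1), H.mul_mem_cancel_left h1]
  have hmn : m ∈ normalizer ((H ⊓ eventualCentralizer : Subgroup _) : Set ThompsonF) := by
    refine mem_normalizer_iff.2 fun h => ?_
    simp only [mem_inf]
    have e : m * h * m⁻¹ ∈ eventualCentralizer ↔ h ∈ eventualCentralizer := by
      rw [Normal.mem_comm_iff inferInstance, inv_mul_cancel_left]
    rw [e]
    refine and_congr_left fun ⟨c, hc⟩ => (key h c hc).symm
  refine normalizer_eq_top_iff.1 (eq_top_of_x_mem (hH _ h0) (show 1 ≤ 2 * l by omega) ?_)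
  have := mul_mem (inv_mem hmn) (hH _ hb)
  rwa [inv_mul_cancel_left] at this

end Generation

/-- The subgroup generated by the quotients of positive-index generators. -/
def quotients : Subgroup ThompsonF :=
  Subgroup.closure {g | ∃ i j, 1 ≤ i ∧ 1 ≤ j ∧ g = x i * (x j)⁻¹}

lemma x_mul_inv_mem_quotients {i j : ℕ} (hi : 1 ≤ i) (hj : 1 ≤ j) :
    x i * (x j)⁻¹ ∈ quotients := subset_closure ⟨i, j, hi, hj, rfl⟩

lemma quotients_le {H : Subgroup ThompsonF} (h0 : x 0 ∈ H) (h : x 1 * (x 2)⁻¹ ∈ H) :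
    quotients ≤ H := by
  have h1 : ∀ j, x 1 * (x (1 + j))⁻¹ ∈ H := by
    intro j
    induction j with
    | zero => simp
    | succ j ih =>
      have h2 := mul_mem ih ((shift_mem_iff h0 j _).2 h)
      rw [map_mul, map_inv, shift_x _ le_rfl, shift_x _ one_le_two] at h2
      simpa [mul_assoc, show 2 + j = 1 + (j + 1) by omega] using h2
  refine (closure_le _).2 ?_
  rintro _ ⟨i, j, hi, hj, rfl⟩
  obtain ⟨i, rfl⟩ := Nat.exists_eq_add_of_le hi
  obtain ⟨j, rfl⟩ := Nat.exists_eq_add_of_le hj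
  have h2 := mul_mem (inv_mem (h1 i)) (h1 j)
  simpa [mul_assoc] using h2

theorem closure_pair_eq_top {q : ThompsonF} {l : ℕ} (hl : 6 ≤ l) (hq : q ∈ tail 6)
    (hq' : q ∈ tailCentralizer l) (hq'' : q ∈ quotients) :
    Subgroup.closure {x 0, x 1 * (x 5)⁻¹ * q * x (2 * l)} = (⊤ : Subgroup ThompsonF) := by
  set H : Subgroup ThompsonF := Subgroup.closure {x 0, x 1 * (x 5)⁻¹ * q * x (2 * l)}
  have h0 : x 0 ∈ H := subset_closure (by simp)
  have hb : x 1 * (x 5)⁻¹ * q * x (2 * l) ∈ H := subset_closure (by simp)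
  set m : ThompsonF := x 1 * (x 5)⁻¹ * q with hmdef
  have hm : m ∈ tail 1 := mul_mem (mul_mem (x_mem_tail le_rfl)
    (inv_mem (x_mem_tail (by omega)))) (tail_anti (by omega) hq)
  have hm' : m ∈ tailCentralizer l :=
    mul_mem (tailCentralizer_mono hl (x_mul_inv_mem_tailCentralizer (by omega))) hq'
  have hN := normal_inf_eventualCentralizer h0 (by omega) hm hm' hb
  set N : Subgroup ThompsonF := H ⊓ eventualCentralizer
  let π : ThompsonF →* ThompsonF ⧸ N := QuotientGroup.mk' N
  have hπ : ∀ g h, g * h⁻¹ ∈ N ↔ π g = π h := by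
    intro g h
    rw [← mul_inv_eq_one, ← map_inv, ← map_mul]
    exact (QuotientGroup.eq_one_iff _).symm
  have hshift : ∀ k, π m = π (shift k m) := fun k => (hπ _ _).1
    ⟨mul_shift_inv_mem h0 (by omega) hm hm' hb k, mul_mem ⟨l, hm'⟩
      (eventualCentralizer.inv_mem ⟨l + k, shift_mem_tailCentralizer k (by omega) hm'⟩)⟩
  have hcomm : Commute (π m) (π (x 2 * (x 3)⁻¹)) := by
    rw [hshift 4]
    exact (commute_of_mem_tail (tail_anti (by omega) (shift_mem_tail 4 le_rfl hm))
      (x_mul_inv_mem_tailCentralizer (by omega))).map π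
  have hconj : m⁻¹ * (x 2 * (x 3)⁻¹) * m = x 3 * (x 4)⁻¹ := by
    have c1 : Commute q (x 3 * (x 4)⁻¹) := commute_of_mem_tail (tail_anti (by omega) hq)
      (x_mul_inv_mem_tailCentralizer (by omega))
    have c2 : Commute (x 5) (x 3 * (x 4)⁻¹) := commute_of_mem_tail (x_mem_tail (by omega))
      (x_mul_inv_mem_tailCentralizer (by omega))
    calc m⁻¹ * (x 2 * (x 3)⁻¹) * m
        = q⁻¹ * (x 5 * ((x 1)⁻¹ * (x 2 * (x 3)⁻¹) * x 1)) * (x 5)⁻¹ * q := by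
          rw [hmdef]; group
      _ = q⁻¹ * (x 5 * (x 3 * (x 4)⁻¹)) * (x 5)⁻¹ * q := by rw [x_conj_mul_inv one_lt_two]
      _ = q⁻¹ * (x 3 * (x 4)⁻¹ * q) := by rw [c2.eq]; group
      _ = x 3 * (x 4)⁻¹ := by rw [← c1.eq]; group
  have h34 : π (x 2 * (x 3)⁻¹) = π (x 3 * (x 4)⁻¹) := by
    rw [← hconj, map_mul _ (_ * _) m, map_mul _ m⁻¹, map_inv _ m, mul_assoc, ← hcomm.eq,
      inv_mul_cancel_left]
  have h23 : π (x 1 * (x 2)⁻¹) = π (x 2 * (x 3)⁻¹) := by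
    have h := h34
    rw [← x_conj_mul_inv (show 0 < 1 by omega), ← x_conj_mul_inv (show 0 < 2 by omega)] at h
    simpa only [map_mul, map_inv, mul_right_inj, mul_left_inj] using h
  have hcomm1 : Commute (π (x 1)) (π (x 2)) := by
    have e1 : (π (x 1))⁻¹ * π (x 2 * (x 3)⁻¹) * π (x 1) = π (x 3 * (x 4)⁻¹) := by
      rw [← x_conj_mul_inv one_lt_two, map_mul _ (_ * _) (x 1), map_mul _ (x 1)⁻¹, map_inv _ (x 1)]
    rw [← h34, ← h23] at e1
    simp only [map_mul, map_inv, inv_mul_cancel_left] at e1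
    have e2 : Commute (π (x 2))⁻¹ (π (x 1)) := e1
    simpa using e2.inv_left.symm
  have h12 : π (x 2) = π (x 3) := by
    rw [← x_conj (show 1 < 2 by omega)]
    simp only [map_mul, map_inv]
    rw [mul_assoc, ← hcomm1.eq, inv_mul_cancel_left]
  have hmem : x 1 * (x 2)⁻¹ ∈ H := by
    refine ((hπ _ _).2 ?_).1
    rw [← mul_inv_eq_one, ← map_inv, ← map_mul, h23, map_mul, map_inv, h12, mul_inv_cancel]
  have hle := quotients_le h0 hmem
  have hmH : m ∈ H := mul_mem (hle (x_mul_inv_mem_quotients (by omega) (by omega))) (hle hq'')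
  exact eq_top_of_x_mem h0 (show 1 ≤ 2 * l by omega) ((H.mul_mem_cancel_left hmH).1 hb)

/-- The homeomorphism of the line that is the identity on `(-∞, j]` and the translation by `-1`
on `[j + 2, ∞)`, with slope `1 / 2` in between. -/
noncomputable def bend (j : ℝ) : ℝ ≃o ℝ :=
  StrictMono.orderIsoOfRightInverse (fun t => min t (max ((t + j) / 2) (t - 1)))
    (fun s t h => min_lt_min h (max_lt_max (by linarith) (by linarith)))
    (fun t => max t (min (2 * t - j) (t + 1))) (by
      intro t
      dsimp only
      grind)

lemma bend_apply (j t : ℝ) : bend j t = min t (max ((t + j) / 2) (t - 1)) := rfl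

lemma bend_of_le {j t : ℝ} (h : t ≤ j) : bend j t = t := by
  rw [bend_apply, min_eq_left]
  exact le_max_of_le_left (by linarith)

lemma bend_of_ge {j t : ℝ} (h : j + 2 ≤ t) : bend j t = t - 1 := by
  rw [bend_apply, max_eq_right (by linarith), min_eq_right (by linarith)]

lemma bend_inv_apply (j t : ℝ) : (bend j)⁻¹ t = max t (min (2 * t - j) (t + 1)) := rfl

/-- The action of the generators of `F` on the line. -/
noncomputable def lineGen : ℕ → (ℝ ≃o ℝ)
  | 0 => OrderIso.addRight (-1)
  | j + 1 => bend (j + 1)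

lemma lineGen_zero (t : ℝ) : lineGen 0 t = t - 1 := by
  simp [lineGen, sub_eq_add_neg]

lemma lineGen_zero_inv (t : ℝ) : (lineGen 0)⁻¹ t = t + 1 :=
  (lineGen 0).injective (by rw [RelIso.apply_inv_self, lineGen_zero]; ring)

lemma lineGen_of_pos {j : ℕ} (h : 1 ≤ j) : lineGen j = bend j := by
  obtain ⟨j, rfl⟩ := Nat.exists_eq_add_of_le' h
  simp [lineGen]

lemma lineGen_mul_lineGen {i j : ℕ} (h : i < j) :
    lineGen j * lineGen i = lineGen i * lineGen (j + 1) := by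
  ext t
  rw [RelIso.mul_apply, RelIso.mul_apply, lineGen_of_pos (show 1 ≤ j by omega),
    lineGen_of_pos (show 1 ≤ j + 1 by omega)]
  rcases Nat.eq_zero_or_pos i with rfl | hi
  · rw [lineGen_zero, lineGen_zero, bend_apply, bend_apply, ← min_sub_sub_right,
      ← max_sub_sub_right]
    push_cast
    ring_nf
  · rw [lineGen_of_pos hi]
    have hij : (i : ℝ) + 1 ≤ j := by exact_mod_cast h
    push_cast
    rcases le_total t (i + 2) with ht | ht
    · have h1 : bend i t ≤ i + 1 := by
        have := (bend (i : ℝ)).monotone ht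
        rw [bend_of_ge (le_refl ((i : ℝ) + 2))] at this
        linarith
      rw [bend_of_le (h1.trans hij), bend_of_le (show t ≤ (j : ℝ) + 1 by linarith)]
    · have h1 : (i : ℝ) + 2 ≤ bend (j + 1) t := by
        have := (bend ((j : ℝ) + 1)).monotone ht
        rwa [bend_of_le (by linarith)] at this
      rw [bend_of_ge ht, bend_of_ge h1, bend_apply, bend_apply, ← min_sub_sub_right,
        ← max_sub_sub_right]
      ring_nf

/-- The action of `F` on the line. -/
noncomputable def lineAction : ThompsonF →* (ℝ ≃o ℝ) :=
  PresentedGroup.toGroup (f := lineGen) (by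
    rintro _ ⟨i, j, h, rfl⟩
    simp only [map_mul, map_inv, FreeGroup.lift_apply_of]
    rw [mul_inv_eq_one, mul_inv_eq_iff_eq_mul, lineGen_mul_lineGen h])

lemma lineAction_x (j : ℕ) : lineAction (x j) = lineGen j := PresentedGroup.toGroup.of _

lemma lineAction_x_of_pos {j : ℕ} (h : 1 ≤ j) : lineAction (x j) = bend j := by
  rw [lineAction_x, lineGen_of_pos h]

lemma lineAction_bump {i k : ℕ} (hi : 1 ≤ i) (hk : 1 ≤ k) (t : ℝ) :
    lineAction (x i * (x k)⁻¹) t = bend i ((bend k)⁻¹ t) := by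
  rw [map_mul, map_inv, lineAction_x_of_pos hi, lineAction_x_of_pos hk, RelIso.mul_apply]

lemma lineAction_bump_of_le {i k : ℕ} (hi : 1 ≤ i) (hik : i ≤ k) {t : ℝ} (h : t ≤ i) :
    lineAction (x i * (x k)⁻¹) t = t := by
  have hik' : (i : ℝ) ≤ k := by exact_mod_cast hik
  rw [lineAction_bump hi (hi.trans hik), bend_inv_apply,
    max_eq_left (min_le_of_left_le (by linarith)), bend_of_le h]

lemma lineAction_bump_of_ge {i k : ℕ} (hi : 1 ≤ i) (hik : i ≤ k) {t : ℝ} (h : k + 1 ≤ t) :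
    lineAction (x i * (x k)⁻¹) t = t := by
  have hik' : (i : ℝ) ≤ k := by exact_mod_cast hik
  rw [lineAction_bump hi (hi.trans hik), bend_inv_apply, min_eq_right (by linarith),
    max_eq_right (by linarith), bend_of_ge (by linarith)]
  ring

lemma lineAction_bump_le {i k : ℕ} (hi : 1 ≤ i) (hik : i + 2 ≤ k) {t : ℝ} (h : (i : ℝ) ≤ t) :
    lineAction (x i * (x k)⁻¹) t ≤ t := by
  have hik' : (i : ℝ) + 2 ≤ k := by exact_mod_cast hik
  rw [lineAction_bump hi (by omega), bend_inv_apply, bend_apply]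
  grind

lemma lineAction_bump_le_sub {i k : ℕ} (hi : 1 ≤ i) (hik : i + 2 ≤ k) {t : ℝ}
    (h : (i : ℝ) + 1 / 2 ≤ t) (h' : t ≤ k + 1 / 2) :
    lineAction (x i * (x k)⁻¹) t ≤ t - 1 / 4 := by
  have hik' : (i : ℝ) + 2 ≤ k := by exact_mod_cast hik
  rw [lineAction_bump hi (by omega), bend_inv_apply, bend_apply]
  grind

lemma pow_apply_of_apply_eq {f : ℝ ≃o ℝ} {t : ℝ} (h : f t = t) (r : ℕ) : (f ^ r) t = t := by
  induction r with
  | zero => simp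
  | succ r ih => rw [pow_succ, RelIso.mul_apply, h, ih]

lemma lineAction_bump_pow {i k : ℕ} (hi : 1 ≤ i) (hik : i + 2 ≤ k) {r : ℕ} (hr : 4 * (k - i) < r)
    {t : ℝ} (h : (i : ℝ) ≤ t) (h' : t ≤ k + 1 / 2) :
    (i : ℝ) ≤ lineAction ((x i * (x k)⁻¹) ^ r) t ∧
      lineAction ((x i * (x k)⁻¹) ^ r) t < i + 1 / 2 := by
  have key : ∀ r : ℕ, (i : ℝ) ≤ lineAction ((x i * (x k)⁻¹) ^ r) t ∧
      lineAction ((x i * (x k)⁻¹) ^ r) t ≤ t ∧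
      (lineAction ((x i * (x k)⁻¹) ^ r) t < i + 1 / 2 ∨
        lineAction ((x i * (x k)⁻¹) ^ r) t ≤ t - r / 4) := by
    intro r
    induction r with
    | zero => simp [h]
    | succ r ih =>
      rw [pow_succ', map_mul, RelIso.mul_apply]
      set s := lineAction ((x i * (x k)⁻¹) ^ r) t
      have h1 := (lineAction (x i * (x k)⁻¹)).monotone ih.1
      rw [lineAction_bump_of_le hi (by omega) le_rfl] at h1
      have h2 := lineAction_bump_le hi hik ih.1
      refine ⟨h1, h2.trans ih.2.1, ?_⟩
      rcases lt_or_ge s (i + 1 / 2) with h3 | h3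
      · exact Or.inl (h2.trans_lt h3)
      · have h4 := lineAction_bump_le_sub hi hik h3 (ih.2.1.trans h')
        have h5 := ih.2.2.resolve_left h3.not_gt
        right
        push_cast
        linarith
  obtain ⟨h1, h2, h3⟩ := key r
  refine ⟨h1, ?_⟩
  rcases h3 with h3 | h3
  · exact h3
  · have hr' : 4 * ((k : ℝ) - i) + 1 ≤ r := by
      rw [← Nat.cast_sub (by omega)]
      exact_mod_cast hr
    linarith

/-- A product of powers of `s` bumps, supported on consecutive intervals of length `k + 1`. -/
def blocks (k : ℕ) : ℕ → ThompsonF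
  | 0 => 1
  | s + 1 => blocks k s *
      (x ((s + 1) * (k + 1)) * (x ((s + 1) * (k + 1) + k))⁻¹) ^ (4 * k + 1)

lemma blocks_mem_tail (k s : ℕ) : blocks k s ∈ tail (k + 1) := by
  induction s with
  | zero => exact one_mem _
  | succ s ih =>
    exact mul_mem ih (pow_mem (mul_mem (x_mem_tail (by nlinarith))
      (inv_mem (x_mem_tail (by nlinarith)))) _)

lemma blocks_mem_tailCentralizer (k s : ℕ) :
    blocks k s ∈ tailCentralizer ((s + 1) * (k + 1)) := by
  induction s with
  | zero => exact one_mem _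
  | succ s ih =>
    refine mul_mem (tailCentralizer_mono (by nlinarith) ih) (pow_mem ?_ _)
    exact tailCentralizer_mono (by nlinarith) (x_mul_inv_mem_tailCentralizer (by omega))

lemma blocks_mem_quotients (k s : ℕ) : blocks k s ∈ quotients := by
  induction s with
  | zero => exact one_mem _
  | succ s ih =>
    exact mul_mem ih (pow_mem (x_mul_inv_mem_quotients (by nlinarith) (by nlinarith)) _)

lemma lineAction_blocks_of_ge {k s : ℕ} {t : ℝ} (h : ((s : ℝ) + 1) * (k + 1) ≤ t) :
    lineAction (blocks k s) t = t := by
  induction s with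
  | zero => simp [blocks]
  | succ s ih =>
    push_cast at h
    have hk : (0 : ℝ) ≤ k := k.cast_nonneg
    rw [blocks, map_mul, RelIso.mul_apply, map_pow, pow_apply_of_apply_eq, ih (by nlinarith)]
    refine lineAction_bump_of_ge (by nlinarith) (by omega) ?_
    push_cast
    linarith

lemma lineAction_blocks {k : ℕ} (hk : 2 ≤ k) {S s : ℕ} (hs : 1 ≤ s) (hsS : s ≤ S) {t : ℝ}
    (h : (s : ℝ) * (k + 1) ≤ t) (h' : t ≤ (s + 1) * (k + 1) - 1 / 2) :
    (s : ℝ) * (k + 1) ≤ lineAction (blocks k S) t ∧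
      lineAction (blocks k S) t < s * (k + 1) + 1 / 2 := by
  induction S with
  | zero => omega
  | succ S ih =>
    rw [blocks, map_mul, RelIso.mul_apply]
    rcases Nat.lt_or_ge S s with h1 | h1
    · obtain rfl : s = S + 1 := by omega
      have h2 := lineAction_bump_pow (i := (S + 1) * (k + 1)) (k := (S + 1) * (k + 1) + k)
        (r := 4 * k + 1) (t := t) (by nlinarith) (by omega) (by omega)
        (by push_cast at h ⊢; exact h) (by push_cast at h' ⊢; linarith)
      push_cast at h2 ⊢
      rwa [lineAction_blocks_of_ge h2.1]
    · have h2 : ((s : ℝ) + 1) ≤ S + 1 := by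
        have : (s : ℝ) ≤ S := by exact_mod_cast h1
        linarith
      have h3 : (0 : ℝ) ≤ k + 1 := by positivity
      have h4 := mul_le_mul_of_nonneg_right h2 h3
      rw [map_pow, pow_apply_of_apply_eq]
      · exact ih h1
      · refine lineAction_bump_of_le (by nlinarith) (by omega) ?_
        push_cast
        linarith

section PingPong

variable {N t₀ : ℝ} {s₀ : ℤ}

/-- The possible positions of the image of the base point `t₀` under a reduced word of length `l`
with the given first letter, where the letter `0` acts as the translation by `-1` and the letter `1`
contracts the intervals between consecutive multiples of `N`. -/
def Reachable (N t₀ : ℝ) (s₀ : ℤ) (l : ℕ) : Fin 2 × Bool → ℝ → Prop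
  | (0, true), t => t = t₀ - l ∨
      ∃ s : ℤ, |s - s₀| ≤ l ∧ s * N - l - 1 / 2 < t ∧ t < s * N - 1 / 2
  | (0, false), t => t = t₀ + l ∨
      ∃ s : ℤ, |s - s₀| ≤ l ∧ s * N + 1 / 2 < t ∧ t < s * N + l + 1 / 2
  | (1, true), t => ∃ s : ℤ, |s - s₀| ≤ l ∧ s * N ≤ t ∧ t < s * N + 1 / 2
  | (1, false), t => ∃ s : ℤ, |s - s₀| ≤ l ∧ s * N - 1 / 2 < t ∧ t ≤ s * N

lemma Reachable.ne {n l : ℕ} (hN : 2 * n + 2 ≤ N) (ht₀ : t₀ = s₀ * N + n + 1) (hl : l ≤ n)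
    (hl' : 1 ≤ l) {a : Fin 2 × Bool} {t : ℝ} (h : Reachable N t₀ s₀ l a t) : t ≠ t₀ := by
  have hn : (l : ℝ) ≤ n := by exact_mod_cast hl
  have hl1 : (1 : ℝ) ≤ l := by exact_mod_cast hl'
  have key : ∀ s : ℤ, (s : ℝ) * N ≤ s₀ * N ∨ s₀ * N + N ≤ s * N := by
    intro s
    rcases le_or_gt s s₀ with h | h
    · left
      have : (s : ℝ) ≤ s₀ := by exact_mod_cast h
      exact mul_le_mul_of_nonneg_right this (by linarith)
    · right
      have : (s₀ : ℝ) + 1 ≤ s := by exact_mod_cast h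
      linarith [mul_le_mul_of_nonneg_right this (show 0 ≤ N by linarith)]
  rintro rfl
  match a, h with
  | (0, true), Or.inl h => linarith
  | (0, true), Or.inr ⟨s, _, h1, h2⟩ => rcases key s with h3 | h3 <;> linarith
  | (0, false), Or.inl h => linarith
  | (0, false), Or.inr ⟨s, _, h1, h2⟩ => rcases key s with h3 | h3 <;> linarith
  | (1, true), ⟨s, _, h1, h2⟩ => rcases key s with h3 | h3 <;> linarith
  | (1, false), ⟨s, _, h1, h2⟩ => rcases key s with h3 | h3 <;> linarith

lemma Reachable.exists_mid {n l : ℕ} (hN : 2 * n + 2 ≤ N) (ht₀ : t₀ = s₀ * N + n + 1)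
    (hl : l ≤ n) {e : Bool} {t : ℝ} (h : Reachable N t₀ s₀ l (0, e) t) :
    ∃ s : ℤ, |s - s₀| ≤ l + 1 ∧ |s + 1 - s₀| ≤ l + 1 ∧ s * N + 1 / 2 ≤ t ∧
      t ≤ (s + 1) * N - 1 / 2 := by
  have hn : (l : ℝ) ≤ n := by exact_mod_cast hl
  match e, h with
  | true, Or.inl h => exact ⟨s₀, by simp; omega, by simp, by linarith, by linarith⟩
  | true, Or.inr ⟨s, hs, h1, h2⟩ =>
    exact ⟨s - 1, by grind, by grind, by push_cast; linarith, by push_cast; linarith⟩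
  | false, Or.inl h => exact ⟨s₀, by simp; omega, by simp, by linarith, by linarith⟩
  | false, Or.inr ⟨s, hs, h1, h2⟩ => exact ⟨s, by grind, by grind, by linarith, by linarith⟩

/-- The action of a letter on the line. -/
def letterAction (α β : ℝ ≃o ℝ) (a : Fin 2 × Bool) : ℝ ≃o ℝ :=
  cond a.2 (if a.1 = 0 then α else β) (if a.1 = 0 then α else β)⁻¹

variable {α β : ℝ ≃o ℝ} {n : ℕ}

lemma inv_apply_near (hN : 2 * n + 2 ≤ N)
    (hβ : ∀ s : ℤ, |s - s₀| ≤ n + 1 → ∀ t : ℝ, s * N ≤ t → t ≤ (s + 1) * N - 1 / 2 →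
      s * N ≤ β t ∧ β t < s * N + 1 / 2) {s : ℤ} (hs : |s - s₀| ≤ n + 1)
    (hs' : |s + 1 - s₀| ≤ n + 1) {t : ℝ} (h : s * N + 1 / 2 ≤ t) (h' : t ≤ (s + 1) * N) :
    (s + 1) * N - 1 / 2 < β⁻¹ t ∧ β⁻¹ t ≤ (s + 1) * N := by
  have hn : (0 : ℝ) ≤ n := n.cast_nonneg
  have hy : β (β⁻¹ t) = t := RelIso.apply_inv_self _ _
  have h1 := hβ s hs (s * N) le_rfl (by linarith)
  have h2 := (hβ (s + 1) hs' ((s + 1) * N) (by push_cast; rfl) (by push_cast; linarith)).1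
  push_cast at h2
  constructor
  · by_contra! h3
    have h4 : s * N ≤ β⁻¹ t := by
      rw [← β.le_iff_le, hy]
      linarith
    have := (hβ s hs _ h4 h3).2
    linarith
  · rw [← β.le_iff_le, hy]
    linarith

lemma reachable_cons (hN : 2 * n + 2 ≤ N) (ht₀ : t₀ = s₀ * N + n + 1)
    (hα : ∀ t, α t = t - 1) (hα' : ∀ t, α⁻¹ t = t + 1)
    (hβ : ∀ s : ℤ, |s - s₀| ≤ n + 1 → ∀ t : ℝ, s * N ≤ t → t ≤ (s + 1) * N - 1 / 2 →
      s * N ≤ β t ∧ β t < s * N + 1 / 2) {l : ℕ} (hl : l + 1 ≤ n) (hl' : 1 ≤ l)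
    {a b : Fin 2 × Bool} (hab : a.1 = b.1 → a.2 = b.2) {t : ℝ} (h : Reachable N t₀ s₀ l b t) :
    Reachable N t₀ s₀ (l + 1) a (letterAction α β a t) := by
  have hn : (l : ℝ) + 1 ≤ n := by exact_mod_cast hl
  have hl1 : (1 : ℝ) ≤ l := by exact_mod_cast hl'
  match a, b, hab, h with
  | (0, true), (0, true), _, Or.inl h =>
    left
    simp only [letterAction, cond, if_true, hα]
    push_cast
    linarith
  | (0, true), (0, true), _, Or.inr ⟨s, hs, h1, h2⟩ =>
    right
    simp only [letterAction, cond, if_true, hα]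
    refine ⟨s, by grind, ?_, ?_⟩ <;> push_cast <;> linarith
  | (0, false), (0, false), _, Or.inl h =>
    left
    simp only [letterAction, cond, if_true, hα']
    push_cast
    linarith
  | (0, false), (0, false), _, Or.inr ⟨s, hs, h1, h2⟩ =>
    right
    simp only [letterAction, cond, if_true, hα']
    refine ⟨s, by grind, ?_, ?_⟩ <;> push_cast <;> linarith
  | (0, true), (1, true), _, ⟨s, hs, h1, h2⟩ | (0, true), (1, false), _, ⟨s, hs, h1, h2⟩ =>
    right
    simp only [letterAction, cond, if_true, hα]
    refine ⟨s, by grind, ?_, ?_⟩ <;> push_cast <;> linarith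
  | (0, false), (1, true), _, ⟨s, hs, h1, h2⟩ | (0, false), (1, false), _, ⟨s, hs, h1, h2⟩ =>
    right
    simp only [letterAction, cond, if_true, hα']
    refine ⟨s, by grind, ?_, ?_⟩ <;> push_cast <;> linarith
  | (1, true), (0, e), _, h =>
    obtain ⟨s, h1, h2, h3, h4⟩ := Reachable.exists_mid hN ht₀ (by omega) h
    exact ⟨s, by grind, hβ s (by grind) t (by linarith) h4⟩
  | (1, false), (0, e), _, h =>
    obtain ⟨s, h1, h2, h3, h4⟩ := Reachable.exists_mid hN ht₀ (by omega) h
    refine ⟨s + 1, by grind, ?_⟩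
    push_cast
    exact inv_apply_near hN hβ (by grind) (by grind) h3 (by linarith)
  | (1, true), (1, true), _, ⟨s, hs, h1, h2⟩ =>
    exact ⟨s, by grind, hβ s (by grind) t h1 (by linarith)⟩
  | (1, false), (1, false), _, ⟨s, hs, h1, h2⟩ =>
    refine ⟨s, by grind, ?_⟩
    have := inv_apply_near (s := s - 1) (t := t) hN hβ (by grind) (by grind)
      (by push_cast; linarith) (by push_cast; linarith)
    push_cast at this
    rwa [sub_add_cancel] at this
  | (0, true), (0, false), hab, _ | (0, false), (0, true), hab, _
  | (1, true), (1, false), hab, _ | (1, false), (1, true), hab, _ => simp at hab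

lemma reachable_singleton (hN : 2 * n + 2 ≤ N) (ht₀ : t₀ = s₀ * N + n + 1)
    (hα : ∀ t, α t = t - 1) (hα' : ∀ t, α⁻¹ t = t + 1)
    (hβ : ∀ s : ℤ, |s - s₀| ≤ n + 1 → ∀ t : ℝ, s * N ≤ t → t ≤ (s + 1) * N - 1 / 2 →
      s * N ≤ β t ∧ β t < s * N + 1 / 2) (a : Fin 2 × Bool) :
    Reachable N t₀ s₀ 1 a (letterAction α β a t₀) := by
  have hn : (0 : ℝ) ≤ n := n.cast_nonneg
  match a with
  | (0, true) => exact Or.inl (by simp [letterAction, hα])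
  | (0, false) => exact Or.inl (by simp [letterAction, hα'])
  | (1, true) => exact ⟨s₀, by simp, hβ s₀ (by simp; omega) t₀ (by linarith) (by linarith)⟩
  | (1, false) =>
    refine ⟨s₀ + 1, by simp, ?_⟩
    push_cast
    exact inv_apply_near hN hβ (by simp; omega) (by simp) (by linarith) (by linarith)

theorem lift_ne_one_of_contracting (hN : 2 * n + 2 ≤ N) (hα : ∀ t, α t = t - 1)
    (hα' : ∀ t, α⁻¹ t = t + 1)
    (hβ : ∀ s : ℤ, |s - s₀| ≤ n + 1 → ∀ t : ℝ, s * N ≤ t → t ≤ (s + 1) * N - 1 / 2 →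
      s * N ≤ β t ∧ β t < s * N + 1 / 2)
    {w : FreeGroup (Fin 2)} (hw : w ≠ 1) (hwn : w.toWord.length ≤ n) :
    FreeGroup.lift (fun j : Fin 2 => if j = 0 then α else β) w ≠ 1 := by
  set t₀ : ℝ := s₀ * N + n + 1 with ht₀
  have key : ∀ (L : List (Fin 2 × Bool)) (a : Fin 2 × Bool), FreeGroup.IsReduced (a :: L) →
      (a :: L).length ≤ n → Reachable N t₀ s₀ (a :: L).length a
        (FreeGroup.lift (fun j : Fin 2 => if j = 0 then α else β) (FreeGroup.mk (a :: L)) t₀) := by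
    have hcons : ∀ (L : List (Fin 2 × Bool)) (a : Fin 2 × Bool),
        FreeGroup.lift (fun j : Fin 2 => if j = 0 then α else β) (FreeGroup.mk (a :: L)) t₀ =
        letterAction α β a
          (FreeGroup.lift (fun j : Fin 2 => if j = 0 then α else β) (FreeGroup.mk L) t₀) := by
      intro L a
      simp only [FreeGroup.lift_mk, List.map_cons, List.prod_cons, RelIso.mul_apply]
      rfl
    intro L
    induction L with
    | nil =>
      intro a _ _
      rw [hcons]
      exact reachable_singleton hN ht₀ hα hα' hβ a
    | cons b L ih =>
      intro a hred hlen
      rw [FreeGroup.isReduced_cons_cons] at hred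
      rw [hcons]
      exact reachable_cons hN ht₀ hα hα' hβ hlen (by simp) hred.1
        (ih b hred.2 (by simp at hlen ⊢; omega))
  intro h1
  have hne : w.toWord ≠ [] := by simpa using hw
  obtain ⟨a, L, haL⟩ := List.exists_cons_of_ne_nil hne
  have hred := FreeGroup.isReduced_toWord (x := w)
  rw [haL] at hred hwn
  have h2 := key L a hred hwn
  rw [← haL, FreeGroup.mk_toWord, h1, RelIso.one_apply] at h2
  exact h2.ne hN ht₀ (haL ▸ hwn) (by simp [haL]) rfl

end PingPong

/-- The second generator in a pair without short relations. -/
def contracting (n : ℕ) : ThompsonF :=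
  x 1 * (x 5)⁻¹ * blocks (2 * n + 5) (2 * n + 3) * x (2 * ((2 * n + 4) * (2 * n + 6)))

lemma lineAction_contracting (n : ℕ) {s : ℤ} (hs : |s - (n + 2 : ℤ)| ≤ n + 1) {t : ℝ}
    (h : s * (2 * n + 6 : ℝ) ≤ t) (h' : t ≤ (s + 1) * (2 * n + 6 : ℝ) - 1 / 2) :
    s * (2 * n + 6 : ℝ) ≤ lineAction (contracting n) t ∧
      lineAction (contracting n) t < s * (2 * n + 6 : ℝ) + 1 / 2 := by
  rw [abs_le] at hs
  lift s to ℕ using (by omega)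
  have hn : (0 : ℝ) ≤ n := n.cast_nonneg
  have hs1 : (1 : ℝ) ≤ s := by exact_mod_cast (show 1 ≤ s by omega)
  have hs2 : (s : ℝ) + 1 ≤ 2 * n + 4 := by exact_mod_cast (show s + 1 ≤ 2 * n + 4 by omega)
  push_cast at h h' ⊢
  have e1 : lineAction (x (2 * ((2 * n + 4) * (2 * n + 6)))) t = t := by
    rw [lineAction_x_of_pos (by nlinarith), bend_of_le]
    push_cast
    nlinarith
  have h1 := lineAction_blocks (k := 2 * n + 5) (by omega) (S := 2 * n + 3) (s := s) (by omega)
    (by omega) (t := t) (by push_cast; linarith) (by push_cast; linarith)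
  push_cast at h1
  rw [contracting, map_mul, RelIso.mul_apply, e1, map_mul, RelIso.mul_apply,
    lineAction_bump_of_ge le_rfl (by omega)]
  · constructor <;> linarith
  · push_cast
    nlinarith

lemma closure_contracting (n : ℕ) :
    Subgroup.closure {x 0, contracting n} = (⊤ : Subgroup ThompsonF) :=
  closure_pair_eq_top (by nlinarith) (tail_anti (by omega) (blocks_mem_tail _ _))
    (blocks_mem_tailCentralizer _ _) (blocks_mem_quotients _ _)

/-- The free group of rank 2 is a limit of 2-markings of Thompson's group `F`: there is a
sequence of generating pairs of `F` such that for every `n`, no nonempty reduced word of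
length at most `n` in the `n`-th pair and their inverses represents the identity in `F`. -/
theorem free_group_limit_of_F :
    ∃ X : ℕ → ThompsonF × ThompsonF, ∀ n : ℕ,
      Subgroup.closure {(X n).1, (X n).2} = (⊤ : Subgroup ThompsonF) ∧
      ∀ w : FreeGroup (Fin 2), w ≠ 1 → (FreeGroup.toWord w).length ≤ n →
        FreeGroup.lift (fun j : Fin 2 => if j = 0 then (X n).1 else (X n).2) w ≠ 1 := by
  refine ⟨fun n => (x 0, contracting n), fun n => ⟨closure_contracting n, fun w hw hwn h => ?_⟩⟩
  refine lift_ne_one_of_contracting (n := n) (N := 2 * n + 6) (s₀ := n + 2)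
    (α := lineAction (x 0)) (β := lineAction (contracting n)) (by linarith)
    (fun t => by rw [lineAction_x, lineGen_zero]) (fun t => by rw [lineAction_x, lineGen_zero_inv])
    (fun s hs t h h' => lineAction_contracting n hs h h') hw hwn ?_
  have h1 : FreeGroup.lift (fun j : Fin 2 => if j = 0 then lineAction (x 0)
      else lineAction (contracting n)) = lineAction.comp
      (FreeGroup.lift (fun j : Fin 2 => if j = 0 then x 0 else contracting n)) := by
    ext1 j
    simp [apply_ite lineAction]
  rw [h1, MonoidHom.comp_apply, h, map_one]
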